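/- arXiv:1407.5167 — 4 statements merged into one kernel-verified Lean document; each statement's English description precedes it below -/
import Mathlib

section
/- Let n ≥ 1. Consider the ℚ-linear map T−1 on V_n given by P(X,Y) ↦ P(X+Y, Y) − P(X,Y). Then the sequence 0 → ℚ·Yⁿ → V_n →^{T−1} V_n →^{c_X} ℚ → 0 is exact, where c_X(P) is the coefficient of Xⁿ in P. Equivalently: the kernel of T−1 is exactly the set of scalar multiples of Yⁿ, and the image of T−1 is exactly the set of polynomials in V_n whose coefficient of Xⁿ vanishes. -/
open MvPolynomial

namespace BinaryForm

theorem monomial_eq_C_mul_X_pow_mul_X_pow {R : Type*} [CommSemiring R] (i j : ℕ) (a : R) :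
    monomial (Finsupp.single (0 : Fin 2) i + Finsupp.single 1 j) a =
      C a * (X 0 ^ i * X 1 ^ j) := by
  rw [X_pow_eq_monomial, X_pow_eq_monomial, monomial_mul, C_mul_monomial]
  simp

theorem isHomogeneous_X_pow_mul_X_pow {R : Type*} [CommSemiring R] {k n : ℕ} (hk : k ≤ n) :
    (X 0 ^ k * X 1 ^ (n - k) : MvPolynomial (Fin 2) R).IsHomogeneous n := by
  have h := (isHomogeneous_X_pow (R := R) (0 : Fin 2) k).mul
    (isHomogeneous_X_pow (R := R) (1 : Fin 2) (n - k))
  rwa [Nat.add_sub_cancel' hk] at h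

/-- A binary form of degree `n` is the sum of its terms `a_k X^k Y^(n-k)`. -/
theorem eq_sum_of_isHomogeneous {R : Type*} [CommSemiring R] {n : ℕ}
    {P : MvPolynomial (Fin 2) R} (hP : P.IsHomogeneous n) :
    P = ∑ k ∈ Finset.range (n + 1),
      C (coeff (Finsupp.single 0 k + Finsupp.single 1 (n - k)) P) * (X 0 ^ k * X 1 ^ (n - k)) := by
  classical
  ext d
  simp only [← monomial_eq_C_mul_X_pow_mul_X_pow, coeff_sum, coeff_monomial]
  have key (k : ℕ) (hk : Finsupp.single (0 : Fin 2) k + Finsupp.single 1 (n - k) = d) :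
      k = d 0 := by
    simp [← hk]
  by_cases hd : d 0 + d 1 = n
  · have hd' : Finsupp.single (0 : Fin 2) (d 0) + Finsupp.single 1 (n - d 0) = d := by
      ext i
      fin_cases i
      · simp
      · simp; omega
    rw [Finset.sum_eq_single (d 0), if_pos hd', hd']
    · exact fun k _ hk ↦ if_neg fun h ↦ hk (key k h)
    · exact fun h ↦ absurd (Finset.mem_range.2 (by omega)) h
  · rw [hP.coeff_eq_zero (by simpa [Finsupp.degree_eq_sum] using hd)]
    refine (Finset.sum_eq_zero fun k hk ↦ if_neg fun h ↦ hd ?_).symm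
    have := Finset.mem_range.1 hk
    simp [← h]
    omega

theorem eval_one_zero {R : Type*} [CommSemiring R] {n : ℕ}
    {P : MvPolynomial (Fin 2) R} (hP : P.IsHomogeneous n) :
    eval ![1, 0] P = coeff (Finsupp.single 0 n) P := by
  conv_lhs => rw [eq_sum_of_isHomogeneous hP]
  rw [map_sum, Finset.sum_range_succ, Finset.sum_eq_zero]
  · simp
  · intro k hk
    have : n - k ≠ 0 := by have := Finset.mem_range.1 hk; omega
    simp [this]

/-- The substitution `(X, Y) ↦ (X + Y, Y)`. -/
noncomputable abbrev shift (R : Type*) [CommSemiring R] :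
    MvPolynomial (Fin 2) R →ₐ[R] MvPolynomial (Fin 2) R :=
  bind₁ ![X 0 + X 1, X 1]

theorem eval_shift {R : Type*} [CommSemiring R] (x y : R) (P : MvPolynomial (Fin 2) R) :
    eval ![x, y] (shift R P) = eval ![x + y, y] P := by
  change eval₂Hom (RingHom.id R) _ (bind₁ _ P) = eval₂Hom (RingHom.id R) _ P
  rw [eval₂Hom_bind₁]
  congr 2
  ext i
  fin_cases i <;> simp

/-- A polynomial over a domain of characteristic zero which is invariant under translation by one
is constant. -/
theorem _root_.Polynomial.eq_C_of_forall_eval_add_one {R : Type*} [CommRing R] [IsDomain R]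
    [CharZero R] {p : Polynomial R} (hp : ∀ x, p.eval (x + 1) = p.eval x) :
    p = Polynomial.C (p.eval 0) := by
  refine Polynomial.eq_of_infinite_eval_eq _ _
    ((Set.infinite_range_of_injective (Nat.cast_injective (R := R))).mono ?_)
  rintro _ ⟨m, rfl⟩
  induction m with
  | zero => simp
  | succ m ih => simpa [hp] using ih

theorem shift_eq_self_iff {R : Type*} [CommRing R] [IsDomain R] [CharZero R] {n : ℕ}
    {P : MvPolynomial (Fin 2) R} (hP : P.IsHomogeneous n) :
    shift R P = P ↔ ∃ c : R, P = C c * X 1 ^ n := by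
  constructor
  · intro h
    set a : ℕ → R := fun k ↦ coeff (Finsupp.single 0 k + Finsupp.single 1 (n - k)) P
    let p : Polynomial R := ∑ k ∈ Finset.range (n + 1), Polynomial.C (a k) * Polynomial.X ^ k
    have hp (x : R) : p.eval x = eval ![x, 1] P := by
      rw [eq_sum_of_isHomogeneous hP]
      simp [p, a, Polynomial.eval_finsetSum]
    have hconst := Polynomial.eq_C_of_forall_eval_add_one (p := p) fun x ↦ by
      rw [hp, hp, ← eval_shift, h]
    have ha (k : ℕ) (hk : k ∈ Finset.range (n + 1)) (hk0 : k ≠ 0) : a k = 0 := by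
      have h1 : p.coeff k = a k := by
        simp only [p, Polynomial.finsetSum_coeff, Polynomial.coeff_C_mul_X_pow,
          Finset.sum_ite_eq, if_pos hk]
      rw [← h1, hconst, Polynomial.coeff_C_of_ne_zero hk0]
    refine ⟨a 0, (eq_sum_of_isHomogeneous hP).trans ?_⟩
    rw [Finset.sum_eq_single 0]
    · simp [a]
    · intro k hk hk0
      change C (a k) * _ = 0
      rw [ha k hk hk0, C_0, zero_mul]
    · simp
  · rintro ⟨c, rfl⟩
    simp

/-- The image of the binary forms of degree `n` under `T - 1`. -/
noncomputable abbrev shiftSubOneImage (R : Type*) [CommRing R] (n : ℕ) :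
    Submodule R (MvPolynomial (Fin 2) R) :=
  (homogeneousSubmodule (Fin 2) R n).map ((shift R).toLinearMap - LinearMap.id)

theorem shift_sub_self_X_pow_mul_X_pow {R : Type*} [CommRing R] {k n : ℕ} (hk : k < n) :
    shift R (X 0 ^ (k + 1) * X 1 ^ (n - (k + 1))) - X 0 ^ (k + 1) * X 1 ^ (n - (k + 1)) =
      (∑ j ∈ Finset.range k, ((k + 1).choose j : R) • (X 0 ^ j * X 1 ^ (n - j))) +
        ((k : R) + 1) • (X 0 ^ k * X 1 ^ (n - k)) := by
  have hterm (j : ℕ) (hj : j < k + 1) :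
      (X 0 ^ j * X 1 ^ (k + 1 - j) * ((k + 1).choose j : MvPolynomial (Fin 2) R)) *
        X 1 ^ (n - (k + 1)) = ((k + 1).choose j : R) • (X 0 ^ j * X 1 ^ (n - j)) := by
    rw [show n - j = (k + 1 - j) + (n - (k + 1)) by omega, smul_eq_C_mul, map_natCast]
    ring
  have hlast := hterm k k.lt_succ_self
  rw [Nat.choose_succ_self_right] at hlast
  push_cast at hlast
  rw [← hlast, ← Finset.sum_congr rfl fun j hj ↦
    hterm j ((Finset.mem_range.1 hj).trans k.lt_succ_self)]
  simp only [map_mul, map_pow, bind₁_X_right, Matrix.cons_val_zero, Matrix.cons_val_one,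
    add_pow, Finset.sum_range_succ, add_mul, Finset.sum_mul]
  simp

theorem X_pow_mul_X_pow_mem_image {K : Type*} [Field K] [CharZero K] {n : ℕ} (k : ℕ)
    (hk : k < n) : X 0 ^ k * X 1 ^ (n - k) ∈ shiftSubOneImage K n := by
  induction k using Nat.strong_induction_on with
  | _ k ih =>
    have hmem : _ ∈ shiftSubOneImage K n := Submodule.mem_map_of_mem
      (f := (shift K).toLinearMap - LinearMap.id)
      ((mem_homogeneousSubmodule n _).2 (isHomogeneous_X_pow_mul_X_pow (R := K) hk))
    have hsum : ∑ j ∈ Finset.range k, ((k + 1).choose j : K) • (X 0 ^ j * X 1 ^ (n - j)) ∈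
        shiftSubOneImage K n :=
      Submodule.sum_mem _ fun j hj ↦ Submodule.smul_mem _ _
        (ih j (Finset.mem_range.1 hj) ((Finset.mem_range.1 hj).trans hk))
    rw [LinearMap.sub_apply, LinearMap.id_apply, AlgHom.toLinearMap_apply,
      shift_sub_self_X_pow_mul_X_pow hk, Submodule.add_mem_iff_right _ hsum,
      Submodule.smul_mem_iff _ (Nat.cast_add_one_ne_zero k)] at hmem
    exact hmem

theorem coeff_eq_zero_iff_mem_image {K : Type*} [Field K] [CharZero K] {n : ℕ}
    {P : MvPolynomial (Fin 2) K} (hP : P.IsHomogeneous n) :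
    coeff (Finsupp.single 0 n) P = 0 ↔
      ∃ Q : MvPolynomial (Fin 2) K, Q.IsHomogeneous n ∧ shift K Q - Q = P := by
  constructor
  · intro h
    suffices P ∈ shiftSubOneImage K n by simpa using this
    rw [eq_sum_of_isHomogeneous hP, Finset.sum_range_succ]
    simp only [Nat.sub_self, Finsupp.single_zero, add_zero, h, C_0, zero_mul]
    refine Submodule.sum_mem _ fun k hk ↦ ?_
    rw [← smul_eq_C_mul]
    exact Submodule.smul_mem _ _ (X_pow_mul_X_pow_mem_image k (Finset.mem_range.1 hk))
  · rintro ⟨Q, -, rfl⟩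
    rw [← eval_one_zero hP, map_sub, eval_shift, add_zero, sub_self]

end BinaryForm

/-- For `n ≥ 1`, on the space `V_n` of homogeneous polynomials of degree `n`
in `X, Y` over `ℚ`, with `(T−1)P := P(X+Y,Y) − P(X,Y)`: the kernel of `T−1` consists exactly
of the scalar multiples of `Yⁿ`, and the image of `T−1` consists exactly of those homogeneous
polynomials of degree `n` whose coefficient of `Xⁿ` vanishes (exactness of
`0 → ℚ·Yⁿ → V_n → V_n → ℚ → 0`). -/
theorem stmt_2 (n : ℕ) (hn : 1 ≤ n) :
    (∀ P : MvPolynomial (Fin 2) ℚ, P.IsHomogeneous n →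
      ((bind₁ (![X 0 + X 1, X 1] : Fin 2 → MvPolynomial (Fin 2) ℚ)) P - P = 0 ↔
        ∃ c : ℚ, P = C c * X 1 ^ n)) ∧
    (∀ P : MvPolynomial (Fin 2) ℚ, P.IsHomogeneous n →
      (coeff (Finsupp.single 0 n) P = 0 ↔
        ∃ Q : MvPolynomial (Fin 2) ℚ, Q.IsHomogeneous n ∧
          (bind₁ (![X 0 + X 1, X 1] : Fin 2 → MvPolynomial (Fin 2) ℚ)) Q - Q = P)) :=
  ⟨fun _ hP ↦ sub_eq_zero.trans (BinaryForm.shift_eq_self_iff hP),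
    fun _ hP ↦ BinaryForm.coeff_eq_zero_iff_mem_image hP⟩
end

section
/- Let c(x) := 1/(eˣ−1) + 1/2 − 1/x for real x ≠ 0. Then: (i) c(−x) = −c(x) for all real x ≠ 0; and (ii) defining F(X,Y) := (c(X−Y) + c(Y))/X − 1/12 + c(X)·c(Y), one has F(X,Y) + F(X−Y, X) + F(−Y, X−Y) = 0 for all real X, Y with X ≠ 0, Y ≠ 0 and X ≠ Y. -/
/-- The function `c(x) = 1/(eˣ−1) + 1/2 − 1/x`. -/
noncomputable def cFun (x : ℝ) : ℝ := 1 / (Real.exp x - 1) + 1 / 2 - 1 / x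

/-- The function `F(X,Y) = (c(X−Y) + c(Y))/X − 1/12 + c(X)·c(Y)`. -/
noncomputable def Ffun (X Y : ℝ) : ℝ :=
  (cFun (X - Y) + cFun Y) / X - 1 / 12 + cFun X * cFun Y

theorem exp_sub_one_ne_zero {x : ℝ} (hx : x ≠ 0) : Real.exp x - 1 ≠ 0 :=
  sub_ne_zero.mpr fun h => hx (Real.exp_eq_one_iff x |>.mp h)

theorem cFun_neg {x : ℝ} (hx : x ≠ 0) : cFun (-x) = -cFun x := by
  have h := exp_sub_one_ne_zero hx
  have h' := exp_sub_one_ne_zero (neg_ne_zero.mpr hx)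
  have hmul : Real.exp (-x) * Real.exp x = 1 := by rw [← Real.exp_add]; simp
  have key : 1 / (Real.exp (-x) - 1) + 1 / (Real.exp x - 1) = -1 := by
    rw [div_add_div _ _ h' h, div_eq_iff (mul_ne_zero h' h)]
    linear_combination hmul
  unfold cFun
  rw [div_neg]
  linear_combination key

/-- The subtraction formula for the hyperbolic cotangent, in terms of
`c(x) + 1/x = coth(x/2)/2`. -/
theorem cFun_sub_add_inv_mul {X Y : ℝ} (hX : X ≠ 0) (hY : Y ≠ 0) (hXY : X ≠ Y) :
    (cFun (X - Y) + 1 / (X - Y)) * ((cFun X + 1 / X) - (cFun Y + 1 / Y)) =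
      1 / 4 - (cFun X + 1 / X) * (cFun Y + 1 / Y) := by
  have h1 := exp_sub_one_ne_zero hX
  have h2 := exp_sub_one_ne_zero hY
  have h3 := exp_sub_one_ne_zero (sub_ne_zero.mpr hXY)
  have hexp : Real.exp X = Real.exp (X - Y) * Real.exp Y := by
    rw [← Real.exp_add, sub_add_cancel]
  simp only [cFun, sub_add_cancel]
  rw [hexp] at h1 ⊢
  field_simp
  ring

/-- (i) `c` is odd: `c(−x) = −c(x)` for `x ≠ 0`;
(ii) `F(X,Y) + F(X−Y, X) + F(−Y, X−Y) = 0` whenever `X ≠ 0`, `Y ≠ 0`, `X ≠ Y`. -/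
theorem stmt_8 :
    (∀ x : ℝ, x ≠ 0 → cFun (-x) = -cFun x) ∧
    (∀ X Y : ℝ, X ≠ 0 → Y ≠ 0 → X ≠ Y →
      Ffun X Y + Ffun (X - Y) X + Ffun (-Y) (X - Y) = 0) := by
  refine ⟨fun x hx => cFun_neg hx, fun X Y hX hY hXY => ?_⟩
  have key := cFun_sub_add_inv_mul hX hY hXY
  have hZ : X - Y ≠ 0 := sub_ne_zero.mpr hXY
  have hrat : (1 / X - 1 / Y) / (X - Y) = -(1 / (X * Y)) := by
    field_simp
    ring
  have e1 : X - Y - X = -Y := by ring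
  have e2 : -Y - (X - Y) = -X := by ring
  simp only [Ffun, e1, e2, cFun_neg hX, cFun_neg hY, div_neg]
  linear_combination key - hrat
end

section
/- Let N ≥ 0 be an integer and let X, Y, u, μ, ν ∈ ℂ with μu + ν ≠ 0. Define h(z) := Σ_{i=0}^{N} (z−u)·(X−zY)^i·(X−uY)^{N−i} / ( (μz+ν)^{i+1} · (μu+ν)^{N−i+1} ). Then for every z ∈ ℂ with μz + ν ≠ 0, h is complex-differentiable at z and h′(z) = (N+1)·(X−zY)^N / (μz+ν)^{N+2}. -/
/-- If `t z * a' = (a z - b) * t'`, where `a'` and `t'` are the derivatives of `a` and `t` at `z`,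
then `t * ∑ i ≤ N, a ^ i * b ^ (N - i)` has derivative `(N + 1) * a z ^ N * t'` at `z`. -/
theorem HasDerivAt.mul_geom_sum₂ {𝕜 : Type*} [NontriviallyNormedField 𝕜] {a t : 𝕜 → 𝕜}
    {a' t' b z : 𝕜} (ha : HasDerivAt a a' z) (ht : HasDerivAt t t' z)
    (h : t z * a' = (a z - b) * t') (N : ℕ) :
    HasDerivAt (fun w => t w * ∑ i ∈ Finset.range (N + 1), a w ^ i * b ^ (N - i))
      (((N : 𝕜) + 1) * a z ^ N * t') z := by
  induction N with
  | zero => simpa using ht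
  | succ N ih =>
    have hsum (w : 𝕜) : t w * ∑ i ∈ Finset.range (N + 1 + 1), a w ^ i * b ^ (N + 1 - i) =
        b * (t w * ∑ i ∈ Finset.range (N + 1), a w ^ i * b ^ (N - i)) + t w * a w ^ (N + 1) := by
      have hshift : ∑ i ∈ Finset.range (N + 1), a w ^ i * b ^ (N + 1 - i) =
          b * ∑ i ∈ Finset.range (N + 1), a w ^ i * b ^ (N - i) := by
        rw [Finset.mul_sum]
        refine Finset.sum_congr rfl fun i hi => ?_
        rw [Nat.succ_sub (Finset.mem_range_succ_iff.mp hi), pow_succ]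
        ring
      rw [Finset.sum_range_succ, hshift, Nat.sub_self]
      ring
    simp_rw [hsum]
    refine ((ih.const_mul b).add (ht.mul (ha.pow (N + 1)))).congr_deriv ?_
    simp only [Pi.pow_apply, Nat.add_sub_cancel]
    push_cast
    linear_combination ((N : 𝕜) + 1) * a z ^ N * h


/-- For `N ≥ 0` and `X, Y, u, μ, ν ∈ ℂ` with `μu + ν ≠ 0`, the function
`h(z) = Σ_{i=0}^{N} (z−u)(X−zY)^i (X−uY)^{N−i} / ((μz+ν)^{i+1} (μu+ν)^{N−i+1})`
is complex-differentiable at every `z` with `μz + ν ≠ 0`, with derivative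
`h′(z) = (N+1)(X−zY)^N/(μz+ν)^{N+2}`. -/
theorem stmt_14 (N : ℕ) (Xc Yc u μ ν : ℂ) (hu : μ * u + ν ≠ 0) (z : ℂ)
    (hz : μ * z + ν ≠ 0) :
    HasDerivAt (fun w : ℂ => ∑ i ∈ Finset.range (N + 1),
        (w - u) * (Xc - w * Yc) ^ i * (Xc - u * Yc) ^ (N - i) /
          ((μ * w + ν) ^ (i + 1) * (μ * u + ν) ^ (N - i + 1)))
      (((N : ℂ) + 1) * (Xc - z * Yc) ^ N / (μ * z + ν) ^ (N + 2)) z := by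
  have hden : HasDerivAt (fun w : ℂ => μ * w + ν) μ z := by
    simpa using ((hasDerivAt_id z).const_mul μ).add_const ν
  have ha : HasDerivAt (fun w : ℂ => (Xc - w * Yc) / (μ * w + ν))
      (-(μ * Xc + ν * Yc) / (μ * z + ν) ^ 2) z := by
    refine ((((hasDerivAt_id z).mul_const Yc).const_sub Xc).div hden hz).congr_deriv ?_
    simp only [id]
    ring
  have ht : HasDerivAt (fun w : ℂ => (w - u) / (μ * w + ν) / (μ * u + ν))
      (1 / (μ * z + ν) ^ 2) z := by
    refine ((((hasDerivAt_id z).sub_const u).div hden hz).div_const (μ * u + ν)).congr_deriv ?_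
    simp only [id]
    field_simp
    ring
  have hrel : (z - u) / (μ * z + ν) / (μ * u + ν) * (-(μ * Xc + ν * Yc) / (μ * z + ν) ^ 2) =
      ((Xc - z * Yc) / (μ * z + ν) - (Xc - u * Yc) / (μ * u + ν)) * (1 / (μ * z + ν) ^ 2) := by
    rw [div_sub_div _ _ hz hu, div_div, div_mul_div_comm, div_mul_div_comm]
    ring
  refine ((ha.mul_geom_sum₂ ht hrel N).congr_deriv ?_).congr_of_eventuallyEq
    (.of_forall fun w => ?_)
  · rw [div_pow, mul_one_div, ← mul_div_assoc, div_div, ← pow_add]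
  · simp only [Finset.mul_sum]
    refine Finset.sum_congr rfl fun i _ => ?_
    simp only [div_pow, pow_succ, div_mul_div_comm, div_div]
    congr 1 <;> ring
end

section
/- Let W be a ℚ-vector space with a direct sum decomposition W = W⁰ ⊕ W^∞, with projections π⁰ : W → W⁰ and π^∞ : W → W^∞ (so π⁰ω = ω − π^∞ω). In the tensor coalgebra T^c(W) = ⊕_{n≥0} W^{⊗n}, let ш denote the shuffle product, defined on pure tensors by (v₁⊗…⊗v_p) ш (v_{p+1}⊗…⊗v_{p+q}) := Σ_{σ} v_{σ^{-1}(1)} ⊗ … ⊗ v_{σ^{-1}(p+q)}, the sum over all (p,q)-shuffles σ (permutations of {1,…,p+q} increasing on {1,…,p} and on {p+1,…,p+q}). Then for every n ≥ 1 and all ω₁, …, ω_n ∈ W: Σ_{i=0}^{n} (−1)^{n−i} · (ω₁⊗…⊗ω_i) ш (π^∞ω_n ⊗ π^∞ω_{n−1} ⊗ … ⊗ π^∞ω_{i+1}) = Σ_{i=1}^{n} (−1)^{n−i} · [ (ω₁⊗…⊗ω_{i−1}) ш (π^∞ω_n ⊗ … ⊗ π^∞ω_{i+1}) ] ⊗ π⁰ω_i.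 -/
/-- A `(p, n−p)`-shuffle: a permutation of `Fin n` which is increasing on the first `p`
positions and on the last `n − p` positions. -/
def IsShuffle (p : ℕ) {n : ℕ} (σ : Equiv.Perm (Fin n)) : Prop :=
  (∀ a b : Fin n, a < b → (b : ℕ) < p → σ a < σ b) ∧
  (∀ a b : Fin n, a < b → p ≤ (a : ℕ) → σ a < σ b)

noncomputable instance (p n : ℕ) :
    DecidablePred (fun σ : Equiv.Perm (Fin n) => IsShuffle p σ) :=
  fun _ => Classical.propDecidable _

/-- The word `ω₁, …, ω_i, π^∞ω_n, π^∞ω_{n−1}, …, π^∞ω_{i+1}` (0-indexed). -/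
def lhsWord {W : Type*} (n i : ℕ) (ω : Fin n → W) (pinf : W → W) : Fin n → W :=
  fun l => if (l : ℕ) < i then ω l
    else pinf (ω ⟨n - 1 - ((l : ℕ) - i), by have := l.isLt; omega⟩)

/-- The word `ω₁, …, ω_i, π^∞ω_n, π^∞ω_{n−1}, …, π^∞ω_{i+2}` of length `n − 1`
(0-indexed, with `i` here standing for the `i − 1` of the informal statement). -/
def rhsWord {W : Type*} (n i : ℕ) (ω : Fin n → W) (pinf : W → W) : Fin (n - 1) → W :=
  fun l => if h : (l : ℕ) < i then ω ⟨l, by have := l.isLt; omega⟩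
    else pinf (ω ⟨n + i - (l : ℕ) - 1, by have := l.isLt; omega⟩)

/-- Insert the position `k` into a permutation of `Fin m`, sending it to the last position. -/
def insertLast {m : ℕ} (k : Fin (m + 1)) (τ : Equiv.Perm (Fin m)) : Equiv.Perm (Fin (m + 1)) :=
  (finSuccEquiv' k).trans ((Equiv.optionCongr τ).trans (finSuccEquiv' (Fin.last m)).symm)

theorem insertLast_self {m : ℕ} (k : Fin (m + 1)) (τ : Equiv.Perm (Fin m)) :
    insertLast k τ k = Fin.last m := by
  simp [insertLast]

theorem insertLast_succAbove {m : ℕ} (k : Fin (m + 1)) (τ : Equiv.Perm (Fin m)) (a : Fin m) :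
    insertLast k τ (k.succAbove a) = (τ a).castSucc := by
  simp [insertLast]

theorem insertLast_inv_last {m : ℕ} (k : Fin (m + 1)) (τ : Equiv.Perm (Fin m)) :
    (insertLast k τ)⁻¹ (Fin.last m) = k := by
  rw [Equiv.Perm.inv_eq_iff_eq, insertLast_self]

theorem insertLast_inv_castSucc {m : ℕ} (k : Fin (m + 1)) (τ : Equiv.Perm (Fin m)) (a : Fin m) :
    (insertLast k τ)⁻¹ a.castSucc = k.succAbove (τ⁻¹ a) := by
  rw [Equiv.Perm.inv_eq_iff_eq, insertLast_succAbove, ← Equiv.Perm.mul_apply, mul_inv_cancel, Equiv.Perm.one_apply]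

theorem insertLast_injective {m : ℕ} (k : Fin (m + 1)) :
    Function.Injective (insertLast k) := by
  intro τ τ' h
  ext a
  have := congrArg (fun σ => σ (k.succAbove a)) h
  simp only [insertLast_succAbove] at this
  rw [Fin.castSucc_injective _ this]

theorem exists_insertLast_eq {m : ℕ} (k : Fin (m + 1)) (σ : Equiv.Perm (Fin (m + 1)))
    (h : σ k = Fin.last m) : ∃ τ, insertLast k τ = σ := by
  have hne (a : Fin m) : σ (k.succAbove a) ≠ Fin.last m := fun h' =>
    Fin.succAbove_ne k a (σ.injective (h'.trans h.symm))
  have hinj : Function.Injective fun a => (σ (k.succAbove a)).castPred (hne a) := fun a b hab =>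
    Fin.succAbove_right_injective (σ.injective (Fin.castPred_inj.mp hab))
  refine ⟨Equiv.ofBijective _ (Finite.injective_iff_bijective.mp hinj), ?_⟩
  refine Equiv.ext fun a => ?_
  rcases Fin.eq_self_or_eq_succAbove k a with rfl | ⟨b, rfl⟩
  · rw [insertLast_self, h]
  · rw [insertLast_succAbove]
    simp

theorem isShuffle_insertLast_iff {m p q : ℕ} {k : Fin (m + 1)}
    (hk : ((k : ℕ) + 1 = p ∧ q = k) ∨ ((k : ℕ) = m ∧ q = p ∧ p ≤ m)) (τ : Equiv.Perm (Fin m)) :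
    IsShuffle p (insertLast k τ) ↔ IsShuffle q τ := by
  have hval (a : Fin m) :
      ((k.succAbove a : Fin (m + 1)) : ℕ) = if (a : ℕ) < k then (a : ℕ) else a + 1 := by
    simp only [Fin.succAbove, Fin.lt_def, Fin.val_castSucc]
    split_ifs <;> simp
  constructor
  · rintro ⟨h₁, h₂⟩
    refine ⟨fun a b hab hb => ?_, fun a b hab ha => ?_⟩
    · have := h₁ (k.succAbove a) (k.succAbove b) (Fin.succAbove_lt_succAbove_iff.mpr hab)
        (by rw [hval]; split_ifs <;> omega)
      simpa only [insertLast_succAbove, Fin.castSucc_lt_castSucc_iff] using this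
    · have := h₂ (k.succAbove a) (k.succAbove b) (Fin.succAbove_lt_succAbove_iff.mpr hab)
        (by rw [hval]; split_ifs <;> omega)
      simpa only [insertLast_succAbove, Fin.castSucc_lt_castSucc_iff] using this
  · rintro ⟨h₁, h₂⟩
    refine ⟨fun a b hab hb => ?_, fun a b hab ha => ?_⟩ <;>
    · rcases Fin.eq_self_or_eq_succAbove k a with rfl | ⟨a, rfl⟩
      · have := b.isLt
        rw [Fin.lt_def] at hab
        omega
      rcases Fin.eq_self_or_eq_succAbove k b with rfl | ⟨b, rfl⟩
      · rw [insertLast_self, insertLast_succAbove]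
        exact Fin.castSucc_lt_last _
      rw [insertLast_succAbove, insertLast_succAbove, Fin.castSucc_lt_castSucc_iff]
      rw [Fin.succAbove_lt_succAbove_iff] at hab
      first
        | refine h₁ a b hab ?_
          rw [hval] at hb
          have := b.isLt
          split_ifs at hb <;> omega
        | refine h₂ a b hab ?_
          rw [hval] at ha
          have := b.isLt
          rw [Fin.lt_def] at hab
          split_ifs at ha <;> omega

/-- The last letter of a shuffle comes from the end of one of the two words. -/
theorem IsShuffle.eq_of_apply_eq_last {m p : ℕ} {σ : Equiv.Perm (Fin (m + 1))}
    (hσ : IsShuffle p σ) {k : Fin (m + 1)} (hk : σ k = Fin.last m) :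
    (k : ℕ) + 1 = p ∨ (k : ℕ) = m := by
  by_contra! h
  have hkm : (k : ℕ) + 1 < m + 1 := by have := k.isLt; omega
  have hlt : k < ⟨k + 1, hkm⟩ := by simp [Fin.lt_def]
  have : σ k < σ ⟨k + 1, hkm⟩ := by
    rcases lt_or_ge (k : ℕ) p with hp | hp
    · exact hσ.1 _ _ hlt (by simp only; omega)
    · exact hσ.2 _ _ hlt hp
  rw [hk] at this
  exact absurd this (Fin.le_last _).not_gt

theorem sum_isShuffle_apply_eq_last {M : Type*} [AddCommMonoid M] {m p q : ℕ} {k : Fin (m + 1)}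
    (hk : ((k : ℕ) + 1 = p ∧ q = k) ∨ ((k : ℕ) = m ∧ q = p ∧ p ≤ m))
    (f : Equiv.Perm (Fin (m + 1)) → M) :
    ∑ σ ∈ Finset.univ.filter (fun σ : Equiv.Perm (Fin (m + 1)) => IsShuffle p σ) with
        σ k = Fin.last m, f σ =
      ∑ τ ∈ Finset.univ.filter (fun τ : Equiv.Perm (Fin m) => IsShuffle q τ),
        f (insertLast k τ) := by
  symm
  refine Finset.sum_nbij (insertLast k) ?_ (insertLast_injective k).injOn ?_ fun _ _ => rfl
  · intro τ hτ
    simp only [Finset.mem_filter, Finset.mem_univ, true_and] at hτ ⊢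
    exact ⟨(isShuffle_insertLast_iff hk τ).mpr hτ, insertLast_self k τ⟩
  · intro σ hσ
    simp only [Finset.coe_filter, Finset.mem_filter, Finset.mem_univ, true_and,
      Set.mem_ofPred_eq] at hσ
    obtain ⟨τ, rfl⟩ := exists_insertLast_eq k σ hσ.2
    refine ⟨τ, ?_, rfl⟩
    simpa using (isShuffle_insertLast_iff hk τ).mp hσ.1

/-- The tensors `(w_{τ⁻¹(1)} ⊗ … ⊗ w_{τ⁻¹(m)}) ⊗ x`, summed over all shuffles `τ`. -/
noncomputable def shuffleSnoc {W : Type*} [AddCommGroup W] [Module ℚ W] {m : ℕ} (p : ℕ)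
    (w : Fin m → W) (x : W) : PiTensorProduct ℚ (fun _ : Fin (m + 1) => W) :=
  ∑ τ ∈ Finset.univ.filter (fun τ : Equiv.Perm (Fin m) => IsShuffle p τ),
    PiTensorProduct.tprod ℚ (fun j : Fin (m + 1) =>
      if h : (j : ℕ) < m then w (τ⁻¹ ⟨j, h⟩) else x)

theorem shuffleSnoc_sub {W : Type*} [AddCommGroup W] [Module ℚ W] {m : ℕ} (p : ℕ)
    (w : Fin m → W) (x y : W) :
    shuffleSnoc p w (x - y) = shuffleSnoc p w x - shuffleSnoc p w y := by
  have key (τ : Equiv.Perm (Fin m)) (z : W) :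
      (fun j : Fin (m + 1) => if h : (j : ℕ) < m then w (τ⁻¹ ⟨j, h⟩) else z) =
        Function.update (fun j : Fin (m + 1) => if h : (j : ℕ) < m then w (τ⁻¹ ⟨j, h⟩) else 0)
          (Fin.last m) z := by
    funext j
    refine Fin.lastCases ?_ (fun a => ?_) j
    · simp
    · simp [(Fin.castSucc_lt_last a).ne]
  simp only [shuffleSnoc, ← Finset.sum_sub_distrib]
  refine Finset.sum_congr rfl fun τ _ => ?_
  rw [key τ (x - y), key τ x, key τ y, MultilinearMap.map_update_sub]

theorem sum_tprod_apply_eq_last {W : Type*} [AddCommGroup W] [Module ℚ W] {m p q : ℕ}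
    {k : Fin (m + 1)}
    (hk : ((k : ℕ) + 1 = p ∧ q = k) ∨ ((k : ℕ) = m ∧ q = p ∧ p ≤ m)) (w : Fin (m + 1) → W) :
    ∑ σ ∈ Finset.univ.filter (fun σ : Equiv.Perm (Fin (m + 1)) => IsShuffle p σ) with
        σ k = Fin.last m, PiTensorProduct.tprod ℚ (fun j => w (σ⁻¹ j)) =
      shuffleSnoc q (fun l => w (k.succAbove l)) (w k) := by
  rw [sum_isShuffle_apply_eq_last hk, shuffleSnoc]
  refine Finset.sum_congr rfl fun τ _ => congrArg _ (funext fun j => ?_)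
  refine Fin.lastCases ?_ (fun a => ?_) j
  · simp [insertLast_inv_last]
  · simp [insertLast_inv_castSucc]

theorem lhsWord_succ_succAbove {W : Type*} {m : ℕ} (i : Fin (m + 1)) (ω : Fin (m + 1) → W)
    (f : W → W) (l : Fin m) :
    lhsWord (m + 1) (i + 1) ω f (i.succAbove l) = rhsWord (m + 1) i ω f l := by
  have hl := l.isLt
  rcases lt_or_ge (l : ℕ) i with h | h
  · rw [Fin.succAbove_of_castSucc_lt _ _ (by simpa [Fin.lt_def] using h)]
    simp only [lhsWord, rhsWord, Fin.val_castSucc, h, Nat.lt_succ_of_lt h, if_true, dif_pos]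
    rfl
  · rw [Fin.succAbove_of_le_castSucc _ _ (by simpa [Fin.le_def] using h)]
    simp only [lhsWord, rhsWord, Fin.val_succ, Nat.succ_lt_succ_iff, h.not_gt, if_false, dif_neg,
      not_false_eq_true]
    congr 3
    omega

theorem lhsWord_castSucc {W : Type*} {m : ℕ} (i : Fin (m + 1)) (ω : Fin (m + 1) → W)
    (f : W → W) (l : Fin m) :
    lhsWord (m + 1) i ω f l.castSucc = rhsWord (m + 1) i ω f l := by
  have hl := l.isLt
  rcases lt_or_ge (l : ℕ) i with h | h
  · simp only [lhsWord, rhsWord, Fin.val_castSucc, h, if_true, dif_pos]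
    rfl
  · simp only [lhsWord, rhsWord, Fin.val_castSucc, h.not_gt, if_false, dif_neg,
      not_false_eq_true]
    congr 3
    omega

theorem lhsWord_succ_self {W : Type*} {m : ℕ} (i : Fin (m + 1)) (ω : Fin (m + 1) → W)
    (f : W → W) : lhsWord (m + 1) (i + 1) ω f i = ω i := by
  simp [lhsWord]

theorem lhsWord_last {W : Type*} {m : ℕ} (i : Fin (m + 1)) (ω : Fin (m + 1) → W)
    (f : W → W) : lhsWord (m + 1) i ω f (Fin.last m) = f (ω i) := by
  have hi := i.isLt
  simp only [lhsWord, Fin.val_last, (Nat.le_of_lt_succ hi).not_gt, if_false]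
  congr 2
  ext
  simp only
  omega

/-- In the tensor coalgebra of `W = W⁰ ⊕ W^∞` with shuffle product `ш`:
`Σ_{i=0}^{n} (−1)^{n−i} (ω₁⊗…⊗ω_i) ш (π^∞ω_n ⊗ … ⊗ π^∞ω_{i+1})
 = Σ_{i=1}^{n} (−1)^{n−i} [(ω₁⊗…⊗ω_{i−1}) ш (π^∞ω_n ⊗ … ⊗ π^∞ω_{i+1})] ⊗ π⁰ω_i`,
where on the right the index `i` of the informal statement is `(i : Fin n) + 1`. -/
theorem stmt_16 {W : Type*} [AddCommGroup W] [Module ℚ W]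
    (pinf p0 : W →ₗ[ℚ] W) (hproj : ∀ w : W, p0 w = w - pinf w)
    (n : ℕ) (hn : 1 ≤ n) (ω : Fin n → W) :
    ∑ i ∈ Finset.range (n + 1), (-1 : ℚ) ^ (n - i) •
      ∑ σ ∈ Finset.univ.filter (fun σ : Equiv.Perm (Fin n) => IsShuffle i σ),
        PiTensorProduct.tprod ℚ (fun j => lhsWord n i ω (⇑pinf) (σ⁻¹ j)) =
    ∑ i : Fin n, (-1 : ℚ) ^ (n - 1 - (i : ℕ)) •
      ∑ σ ∈ Finset.univ.filter (fun σ : Equiv.Perm (Fin (n - 1)) => IsShuffle (i : ℕ) σ),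
        PiTensorProduct.tprod ℚ (fun j : Fin n =>
          if h : (j : ℕ) < n - 1 then rhsWord n (i : ℕ) ω (⇑pinf) (σ⁻¹ ⟨j, h⟩)
          else p0 (ω i)) := by
  obtain ⟨m, rfl⟩ : ∃ m, n = m + 1 := ⟨n - 1, by omega⟩
  set t : ℕ → Equiv.Perm (Fin (m + 1)) → PiTensorProduct ℚ (fun _ : Fin (m + 1) => W) :=
    fun i σ => PiTensorProduct.tprod ℚ (fun j => lhsWord (m + 1) i ω (⇑pinf) (σ⁻¹ j))
  set S : ℕ → Finset (Equiv.Perm (Fin (m + 1))) := fun i =>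
    Finset.univ.filter (fun σ : Equiv.Perm (Fin (m + 1)) => IsShuffle i σ) with hS
  set F := fun i => ∑ σ ∈ S i with ((σ⁻¹ (Fin.last m) : Fin (m + 1)) : ℕ) + 1 = i, t i σ with hF
  set G := fun i => ∑ σ ∈ S i with ¬((σ⁻¹ (Fin.last m) : Fin (m + 1)) : ℕ) + 1 = i, t i σ with hG
  have hsplit (i : ℕ) : ∑ σ ∈ S i, t i σ = F i + G i :=
    (Finset.sum_filter_add_sum_filter_not _ _ _).symm
  have hF0 : F 0 = 0 := by simp [hF]
  have hGlast : G (m + 1) = 0 := by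
    refine Finset.sum_eq_zero fun σ hσ => ?_
    simp only [hS, Finset.mem_filter, Finset.mem_univ, true_and] at hσ
    have := hσ.1.eq_of_apply_eq_last (k := σ⁻¹ (Fin.last m))
      (Equiv.apply_symm_apply σ (Fin.last m))
    omega
  have hFsucc (i : Fin (m + 1)) :
      F (i + 1) = shuffleSnoc i (rhsWord (m + 1) i ω pinf) (ω i) := by
    have h := sum_tprod_apply_eq_last (Or.inl ⟨rfl, rfl⟩) (k := i)
      (lhsWord (m + 1) (i + 1) ω pinf)
    simp only [lhsWord_succ_succAbove, lhsWord_succ_self] at h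
    refine Eq.trans (Finset.sum_congr (Finset.filter_congr fun σ _ => ?_) fun _ _ => rfl) h
    rw [Nat.add_right_cancel_iff, Fin.val_inj, Equiv.Perm.inv_eq_iff_eq, eq_comm]
  have hGcast (i : Fin (m + 1)) :
      G i = shuffleSnoc i (rhsWord (m + 1) i ω pinf) (pinf (ω i)) := by
    have hi := i.isLt
    have h := sum_tprod_apply_eq_last (q := i) (Or.inr ⟨Fin.val_last m, rfl, by omega⟩)
      (lhsWord (m + 1) i ω pinf)
    simp only [Fin.succAbove_last, lhsWord_castSucc, lhsWord_last] at h
    refine Eq.trans (Finset.sum_congr (Finset.filter_congr fun σ hσ => ?_) fun _ _ => rfl) h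
    simp only [hS, Finset.mem_filter, Finset.mem_univ, true_and] at hσ
    have hor := hσ.eq_of_apply_eq_last (k := σ⁻¹ (Fin.last m))
      (Equiv.apply_symm_apply σ (Fin.last m))
    rw [eq_comm (a := σ (Fin.last m)), ← Equiv.Perm.inv_eq_iff_eq, ← Fin.val_inj, Fin.val_last]
    omega
  have hL : ∑ i ∈ Finset.range (m + 1 + 1), (-1 : ℚ) ^ (m + 1 - i) • ∑ σ ∈ S i, t i σ =
      ∑ i : Fin (m + 1), (-1 : ℚ) ^ (m - (i : ℕ)) • (F (i + 1) - G i) := by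
    simp only [hsplit, smul_add, Finset.sum_add_distrib]
    rw [Finset.sum_range_succ', Finset.sum_range_succ (fun i => (-1 : ℚ) ^ (m + 1 - i) • G i),
      hF0, hGlast, smul_zero, smul_zero, add_zero, add_zero, ← Finset.sum_add_distrib,
      Finset.sum_range]
    refine Finset.sum_congr rfl fun i _ => ?_
    have hi := i.isLt
    rw [Nat.add_sub_add_right, show m + 1 - (i : ℕ) = (m - i) + 1 by omega, pow_succ, smul_sub]
    simp [sub_eq_add_neg]
  refine hL.trans (Finset.sum_congr rfl fun i _ => ?_)
  rw [hFsucc, hGcast, ← shuffleSnoc_sub, ← hproj]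
  rfl
end
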